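/- Let G be a finite simple graph with a grounded L-representation, and let < be the linear order on the vertices induced by this representation (u < v iff a u < a v). Then (G,<) avoids the pattern P2; that is, there are no vertices x1 < x2 < x3 < x4 such that x1x2, x1x4 and x2x3 are edges of G while x1x3 is a non-edge of G. -/

import Mathlib

/-- The grounded L-shape with anchor `(a, 0)`, depth `h` and width `w`:
the union of the vertical segment from `(a, 0)` to `(a, -h)` and the
horizontal segment from `(a, -h)` to `(a + w, -h)`. -/
def LShape (a h w : ℝ) : Set (ℝ × ℝ) :=
  segment ℝ ((a, 0) : ℝ × ℝ) ((a, -h) : ℝ × ℝ) ∪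
    segment ℝ ((a, -h) : ℝ × ℝ) ((a + w, -h) : ℝ × ℝ)

/-- A grounded L-representation of a simple graph `G`. -/
structure GroundedLRep {V : Type} (G : SimpleGraph V) where
  a : V → ℝ
  ht : V → ℝ
  wd : V → ℝ
  ht_pos : ∀ v, 0 < ht v
  wd_pos : ∀ v, 0 < wd v
  a_inj : Function.Injective a
  ht_inj : Function.Injective ht
  endpoint_off : ∀ u v, u ≠ v →
    ((a v + wd v, -ht v) : ℝ × ℝ) ∉ LShape (a u) (ht u) (wd u)
  adj_iff : ∀ u v, u ≠ v →
    (G.Adj u v ↔ (LShape (a u) (ht u) (wd u) ∩ LShape (a v) (ht v) (wd v)).Nonempty)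

theorem mem_LShape_iff {a h w : ℝ} (hh : 0 < h) (hw : 0 < w) (p : ℝ × ℝ) :
    p ∈ LShape a h w ↔
      (p.1 = a ∧ -h ≤ p.2 ∧ p.2 ≤ 0) ∨ (a ≤ p.1 ∧ p.1 ≤ a + w ∧ p.2 = -h) := by
  obtain ⟨x, y⟩ := p
  rw [LShape, Set.mem_union, segment_symm ℝ ((a, 0) : ℝ × ℝ),
    ← Prod.image_mk_segment_right, ← Prod.image_mk_segment_left,
    segment_eq_Icc (by linarith), segment_eq_Icc (by linarith)]
  simp only [Set.mem_image, Set.mem_Icc, Prod.mk.injEq]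
  grind

/-- Two grounded L-shapes of distinct depths meet iff the horizontal segment of the left one
crosses the vertical segment of the right one. -/
theorem GroundedLRep.adj_iff_of_lt {V : Type} {G : SimpleGraph V} (R : GroundedLRep G)
    {u v : V} (huv : R.a u < R.a v) :
    G.Adj u v ↔ R.a v ≤ R.a u + R.wd u ∧ R.ht u ≤ R.ht v := by
  have hne : u ≠ v := by
    rintro rfl
    exact huv.false
  have hht : R.ht u ≠ R.ht v := R.ht_inj.ne hne
  have hu := R.ht_pos u
  rw [R.adj_iff u v hne]
  simp only [Set.Nonempty, Set.mem_inter_iff, mem_LShape_iff (R.ht_pos _) (R.wd_pos _)]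
  constructor
  · rintro ⟨p, hpu, hpv⟩
    grind
  · rintro ⟨hw, hh⟩
    exact ⟨(R.a v, -R.ht u), .inr ⟨huv.le, hw, rfl⟩,
      .inl ⟨rfl, by simpa using hh, by simpa using hu.le⟩⟩

/-- Any grounded L-representation of a finite simple graph `G`
induces a vertex order avoiding the pattern `P₂`: there are no four vertices
`x₁ < x₂ < x₃ < x₄` (ordered by anchors) with `x₁x₂`, `x₁x₄`, `x₂x₃` edges and
`x₁x₃` a non-edge. -/
theorem grounded_L_avoids_P2 {V : Type} [Fintype V] (G : SimpleGraph V)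
    (R : GroundedLRep G) :
    ¬ ∃ x1 x2 x3 x4 : V,
        R.a x1 < R.a x2 ∧ R.a x2 < R.a x3 ∧ R.a x3 < R.a x4 ∧
        G.Adj x1 x2 ∧ G.Adj x1 x4 ∧ G.Adj x2 x3 ∧ ¬ G.Adj x1 x3 := by
  rintro ⟨x1, x2, x3, x4, h12, h23, h34, e12, e14, e23, e13⟩
  rw [R.adj_iff_of_lt h12] at e12
  rw [R.adj_iff_of_lt (h12.trans (h23.trans h34))] at e14
  rw [R.adj_iff_of_lt h23] at e23
  rw [R.adj_iff_of_lt (h12.trans h23)] at e13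
  exact e13 ⟨h34.le.trans e14.1, e12.2.trans e23.2⟩
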